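/- arXiv:1810.12053 — 4 statements merged into one kernel-verified Lean document; each statement's English description precedes it below -/
import Mathlib

section
/- In H(e,e,n), for all i, j ∈ ℤ/eℤ, the element t_j t_i belongs to Span(Λ₂). -/
noncomputable section

open scoped Pointwise

/-- The base ring `R₀ = ℤ[a]`. -/
abbrev R0 : Type := Polynomial ℤ

/-- The variable `a ∈ R₀`. -/
def aP : R0 := Polynomial.X

/-- Generators of the Corran–Picantin presentation: `t_i` for `i ∈ ℤ/eℤ` and
`s_j` for `3 ≤ j ≤ n`. -/
inductive HGen (e n : ℕ) : Type
  | t : ZMod e → HGen e n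
  | s : (j : ℕ) → 3 ≤ j → j ≤ n → HGen e n

open FreeAlgebra

/-- The free `R₀`-algebra on the generators. -/
abbrev FA (e n : ℕ) : Type := FreeAlgebra R0 (HGen e n)

/-- The defining relations of the Hecke algebra `H(e,e,n)`. -/
inductive HRel (e n : ℕ) : FA e n → FA e n → Prop
  | tt (i j : ZMod e) :
      HRel e n (ι R0 (HGen.t i) * ι R0 (HGen.t (i - 1)))
               (ι R0 (HGen.t j) * ι R0 (HGen.t (j - 1)))
  | tst (i : ZMod e) (h : 3 ≤ n) :
      HRel e n (ι R0 (HGen.t i) * ι R0 (HGen.s 3 le_rfl h) * ι R0 (HGen.t i))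
               (ι R0 (HGen.s 3 le_rfl h) * ι R0 (HGen.t i) * ι R0 (HGen.s 3 le_rfl h))
  | st (i : ZMod e) (j : ℕ) (h3 : 3 ≤ j) (h4 : 4 ≤ j) (hn : j ≤ n) :
      HRel e n (ι R0 (HGen.s j h3 hn) * ι R0 (HGen.t i))
               (ι R0 (HGen.t i) * ι R0 (HGen.s j h3 hn))
  | braid (i : ℕ) (h3 : 3 ≤ i) (h3' : 3 ≤ i + 1) (hn' : i ≤ n) (hn : i + 1 ≤ n) :
      HRel e n (ι R0 (HGen.s i h3 hn') * ι R0 (HGen.s (i + 1) h3' hn) * ι R0 (HGen.s i h3 hn'))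
               (ι R0 (HGen.s (i + 1) h3' hn) * ι R0 (HGen.s i h3 hn') * ι R0 (HGen.s (i + 1) h3' hn))
  | comm (i j : ℕ) (h3i : 3 ≤ i) (hni : i ≤ n) (h3j : 3 ≤ j) (hnj : j ≤ n)
      (hij : i + 1 < j ∨ j + 1 < i) :
      HRel e n (ι R0 (HGen.s i h3i hni) * ι R0 (HGen.s j h3j hnj))
               (ι R0 (HGen.s j h3j hnj) * ι R0 (HGen.s i h3i hni))
  | tq (i : ZMod e) :
      HRel e n (ι R0 (HGen.t i) * ι R0 (HGen.t i))
               (algebraMap R0 (FA e n) aP * ι R0 (HGen.t i) + 1)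
  | sq (j : ℕ) (h3 : 3 ≤ j) (hn : j ≤ n) :
      HRel e n (ι R0 (HGen.s j h3 hn) * ι R0 (HGen.s j h3 hn))
               (algebraMap R0 (FA e n) aP * ι R0 (HGen.s j h3 hn) + 1)

/-- The Hecke algebra `H(e,e,n)`. -/
abbrev Hecke (e n : ℕ) : Type := RingQuot (HRel e n)

/-- The generator `t_i` of `H(e,e,n)`. -/
def tH (e n : ℕ) (i : ZMod e) : Hecke e n :=
  RingQuot.mkAlgHom R0 (HRel e n) (ι R0 (HGen.t i))

/-- The generator `s_j` of `H(e,e,n)` (junk value `1` when `j` is out of range). -/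
def sH (e n : ℕ) (j : ℕ) : Hecke e n :=
  if h : 3 ≤ j ∧ j ≤ n then RingQuot.mkAlgHom R0 (HRel e n) (ι R0 (HGen.s j h.1 h.2)) else 1

/-- Decreasing-index product `s_m s_{m-1} ⋯ s_{i'}` (empty when `m < i'`). -/
def sDescH (e n m i' : ℕ) : Hecke e n :=
  (((List.range' i' (m + 1 - i')).reverse).map (sH e n)).prod

/-- Increasing-index product `s_{i'} s_{i'+1} ⋯ s_m` (empty when `m < i'`). -/
def sAscH (e n i' m : ℕ) : Hecke e n :=
  ((List.range' i' (m + 1 - i')).map (sH e n)).prod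

/-- `Λ₂ = {1} ∪ {t_k : 0 ≤ k ≤ e-1} ∪ {t_k t₀ : 1 ≤ k ≤ e-1}` in `H(e,e,n)`. -/
def Lam2 (e n : ℕ) : Set (Hecke e n) :=
  {1} ∪ {x | ∃ k < e, x = tH e n (k : ZMod e)} ∪
    {x | ∃ k, 1 ≤ k ∧ k < e ∧ x = tH e n (k : ZMod e) * tH e n 0}

/-- `Λ_m = {1} ∪ {s_m ⋯ s_{i'} : 3 ≤ i' ≤ m} ∪ {s_m ⋯ s₃ t_k : 0 ≤ k ≤ e-1}
∪ {s_m ⋯ s₃ t_k s₂ s₃ ⋯ s_{i'} : 1 ≤ k ≤ e-1, 2 ≤ i' ≤ m}` in `H(e,e,n)`,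
where `s₂ = t₀`. -/
def LamH (e n m : ℕ) : Set (Hecke e n) :=
  {1} ∪ {x | ∃ i', 3 ≤ i' ∧ i' ≤ m ∧ x = sDescH e n m i'} ∪
    {x | ∃ k < e, x = sDescH e n m 3 * tH e n (k : ZMod e)} ∪
    {x | ∃ k, 1 ≤ k ∧ k < e ∧ ∃ i', 2 ≤ i' ∧ i' ≤ m ∧
      x = sDescH e n m 3 * tH e n (k : ZMod e) * tH e n 0 * sAscH e n 3 i'}


theorem tH_tt (e n : ℕ) (i j : ZMod e) :
    tH e n i * tH e n (i - 1) = tH e n j * tH e n (j - 1) := by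
  have h := RingQuot.mkAlgHom_rel R0 (HRel.tt (e := e) (n := n) i j)
  simpa only [tH, map_mul] using h

theorem tH_sq (e n : ℕ) (i : ZMod e) :
    tH e n i * tH e n i = aP • tH e n i + 1 := by
  have h := RingQuot.mkAlgHom_rel R0 (HRel.tq (e := e) (n := n) i)
  rw [← Algebra.smul_def] at h
  simpa only [tH, map_mul, map_add, map_smul, map_one] using h

/-- The recursion `t_j t_{i+1} = a t_{i+1} + t_{j-1} t_i - a t_{j-1}`. -/
theorem tH_step (e n : ℕ) (i j : ZMod e) :
    tH e n j * tH e n (i + 1) =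
      aP • tH e n (i + 1) + tH e n (j - 1) * tH e n i + (-aP) • tH e n (j - 1) := by
  have hc : tH e n (i + 1) * tH e n i = tH e n j * tH e n (j - 1) := by
    have := tH_tt e n (i + 1) j
    rwa [add_sub_cancel_right] at this
  have hi := tH_sq e n i
  have hj := tH_sq e n j
  generalize tH e n (i + 1) = u at *
  generalize tH e n i = v at *
  generalize tH e n j = x at *
  generalize tH e n (j - 1) = y at *
  have h1 : u * v * v = aP • (u * v) + u := by
    rw [mul_assoc, hi, mul_add, mul_smul_comm, mul_one]
  have h2 : x * (u * v) = aP • (u * v) + y := by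
    rw [hc, ← mul_assoc, hj, add_mul, smul_mul_assoc, one_mul]
  have h3 : x * (u * v) * v = aP • (x * (u * v)) + x * u := by
    rw [mul_assoc, h1, mul_add, mul_smul_comm]
  have h4 : x * (u * v) * v = aP • (aP • (u * v) + u) + y * v := by
    rw [h2, add_mul, smul_mul_assoc, h1]
  have h5 : aP • (aP • (u * v) + y) + x * u = aP • (aP • (u * v) + u) + y * v := by
    rw [← h4, h3, h2]
  have h6 : x * u = (aP • (aP • (u * v) + u) + y * v) + (-aP) • (aP • (u * v) + y) := by
    rw [← h5, add_right_comm, ← add_smul, add_neg_cancel, zero_smul, zero_add]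
  rw [h6, smul_add, smul_add]
  calc aP • aP • (u * v) + aP • u + y * v + ((-aP) • aP • (u * v) + (-aP) • y)
      = (aP • aP • (u * v) + (-aP) • aP • (u * v)) + (aP • u + y * v + (-aP) • y) := by abel
    _ = aP • u + y * v + (-aP) • y := by
      rw [← add_smul, add_neg_cancel, zero_smul, zero_add]

/-- For all `i, j ∈ ℤ/eℤ`, the element `t_j t_i` lies in `Span(Λ₂)`. -/
theorem tt_mem_span_Lam2 (e n : ℕ) (he : 1 ≤ e) (hn : 2 ≤ n)
    (hex : ¬(n = 2 ∧ Even e)) (i j : ZMod e) :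
    tH e n j * tH e n i ∈ Submodule.span R0 (Lam2 e n) := by
  have : NeZero e := ⟨by omega⟩
  have ht : ∀ k : ZMod e, tH e n k ∈ Submodule.span R0 (Lam2 e n) := fun k =>
    Submodule.subset_span (Or.inl (Or.inr ⟨k.val, ZMod.val_lt k, by
      rw [ZMod.natCast_zmod_val]⟩))
  have h1 : (1 : Hecke e n) ∈ Submodule.span R0 (Lam2 e n) :=
    Submodule.subset_span (Or.inl (Or.inl rfl))
  have key : ∀ m : ℕ, ∀ j : ZMod e,
      tH e n j * tH e n (m : ZMod e) ∈ Submodule.span R0 (Lam2 e n) := by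
    intro m
    induction m with
    | zero =>
      intro j
      rw [Nat.cast_zero]
      by_cases hj : j = 0
      · rw [hj, tH_sq]
        exact Submodule.add_mem _ (Submodule.smul_mem _ _ (ht 0)) h1
      · refine Submodule.subset_span (Or.inr ⟨j.val, ?_, ZMod.val_lt j, ?_⟩)
        · exact Nat.one_le_iff_ne_zero.mpr (fun h => hj ((ZMod.val_eq_zero j).mp h))
        · rw [ZMod.natCast_zmod_val]
    | succ m ih =>
      intro j
      rw [Nat.cast_succ, tH_step]
      exact Submodule.add_mem _
        (Submodule.add_mem _ (Submodule.smul_mem _ _ (ht _)) (ih _))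
        (Submodule.smul_mem _ _ (ht _))
  have := key i.val j
  rwa [ZMod.natCast_zmod_val] at this
end
end

section
/- In H(e,e,n), for every 1 ≤ k ≤ e−1, the element t_k t₀ belongs to R₀(t₁t₀) + R₀(t₁t₀)² + ⋯ + R₀(t₁t₀)^k + R₀t₁ + R₀t₂ + ⋯ + R₀t_{k−1}. -/
noncomputable section

open scoped Pointwise

open FreeAlgebra

theorem tH_succ_mul (e n : ℕ) (i : ZMod e) :
    tH e n (i + 1) * tH e n i = tH e n 1 * tH e n 0 := by
  have h := tH_tt e n (i + 1) 1
  rwa [add_sub_cancel_right, sub_self] at h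

/-- `c t_i = a c + t_{i+1}` where `c = t₁ t₀`. -/
theorem c_mul_tH (e n : ℕ) (i : ZMod e) :
    (tH e n 1 * tH e n 0) * tH e n i = aP • (tH e n 1 * tH e n 0) + tH e n (i + 1) := by
  rw [← tH_succ_mul e n i, mul_assoc, tH_sq, mul_add, mul_one, mul_smul_comm]

/-- `t_{i+1} = c t_i - a c`, multiplied by `t₀` on the right. -/
theorem tH_succ_mul_zero (e n : ℕ) (i : ZMod e) :
    tH e n (i + 1) * tH e n 0 = (tH e n 1 * tH e n 0) * (tH e n i * tH e n 0)
      + (-aP) • (aP • (tH e n 1 * tH e n 0) + tH e n 1) := by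
  have h0 := c_mul_tH e n 0
  rw [zero_add] at h0
  rw [← h0, ← mul_assoc, c_mul_tH e n i, add_mul, smul_mul_assoc,
    add_right_comm, ← add_smul, add_neg_cancel, zero_smul, zero_add]

theorem tkt0_mem_span_aux (e n : ℕ) (k : ℕ) (hk1 : 1 ≤ k) :
    tH e n (k : ZMod e) * tH e n 0 ∈
      Submodule.span R0
        ({x | ∃ m, 1 ≤ m ∧ m ≤ k ∧ x = (tH e n 1 * tH e n 0) ^ m} ∪
          {x | ∃ m, 1 ≤ m ∧ m ≤ k - 1 ∧ x = tH e n (m : ZMod e)}) := by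
  induction k, hk1 using Nat.le_induction with
  | base =>
    apply Submodule.subset_span
    exact Or.inl ⟨1, le_rfl, le_rfl, by rw [pow_one, Nat.cast_one]⟩
  | succ k hk ih =>
    set S := Submodule.span R0
        ({x | ∃ m, 1 ≤ m ∧ m ≤ k + 1 ∧ x = (tH e n 1 * tH e n 0) ^ m} ∪
          {x | ∃ m, 1 ≤ m ∧ m ≤ k + 1 - 1 ∧ x = tH e n (m : ZMod e)}) with hS
    have hc : tH e n 1 * tH e n 0 ∈ S :=
      Submodule.subset_span (Or.inl ⟨1, le_rfl, by omega, by rw [pow_one]⟩)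
    have ht : tH e n 1 ∈ S :=
      Submodule.subset_span (Or.inr ⟨1, le_rfl, by omega, by rw [Nat.cast_one]⟩)
    have key : ∀ x ∈ Submodule.span R0
        ({x | ∃ m, 1 ≤ m ∧ m ≤ k ∧ x = (tH e n 1 * tH e n 0) ^ m} ∪
          {x | ∃ m, 1 ≤ m ∧ m ≤ k - 1 ∧ x = tH e n (m : ZMod e)}),
        (tH e n 1 * tH e n 0) * x ∈ S := by
      intro x hx
      induction hx using Submodule.span_induction with
      | mem x hx =>
        rcases hx with ⟨m, h1, h2, rfl⟩ | ⟨m, h1, h2, rfl⟩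
        · exact Submodule.subset_span
            (Or.inl ⟨m + 1, by omega, by omega, by rw [pow_succ']⟩)
        · rw [c_mul_tH]
          refine S.add_mem (S.smul_mem _ hc) (Submodule.subset_span (Or.inr ?_))
          exact ⟨m + 1, by omega, by omega, by rw [Nat.cast_add, Nat.cast_one]⟩
      | zero => rw [mul_zero]; exact S.zero_mem
      | add x y _ _ hx hy => rw [mul_add]; exact S.add_mem hx hy
      | smul r x _ hx => rw [mul_smul_comm]; exact S.smul_mem _ hx
    rw [Nat.cast_add, Nat.cast_one, tH_succ_mul_zero]
    have h2 := S.smul_mem (-aP) (S.add_mem (S.smul_mem aP hc) ht)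
    have h1 := key _ ih
    exact S.add_mem h1 h2

/-- For `1 ≤ k ≤ e-1`, `t_k t₀ ∈ R₀(t₁t₀) + R₀(t₁t₀)² + ⋯ + R₀(t₁t₀)^k
+ R₀t₁ + ⋯ + R₀t_{k-1}`. -/
theorem tkt0_mem_span (e n : ℕ) (he : 1 ≤ e) (hn : 2 ≤ n)
    (hex : ¬(n = 2 ∧ Even e)) (k : ℕ) (hk1 : 1 ≤ k) (hk : k ≤ e - 1) :
    tH e n (k : ZMod e) * tH e n 0 ∈
      Submodule.span R0
        ({x | ∃ m, 1 ≤ m ∧ m ≤ k ∧ x = (tH e n 1 * tH e n 0) ^ m} ∪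
          {x | ∃ m, 1 ≤ m ∧ m ≤ k - 1 ∧ x = tH e n (m : ZMod e)}) := by
  exact tkt0_mem_span_aux e n k hk1
end
end

section
/- In H(e,e,n), for every l ∈ ℤ/eℤ and every a₂ ∈ Λ₂, the element t_l · a₂ belongs to Span(Λ₂). -/
noncomputable section

open scoped Pointwise

open FreeAlgebra

theorem shift_aux {R A : Type*} [CommRing R] [Semiring A] [Algebra R A] (c : R) (x x' y y' : A)
    (h1 : y * y' = x * x') (hx : x * x = c • x + 1) (hy' : y' * y' = c • y' + 1) :
    x * y = x' * y' + c • y + (-c) • x' := by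
  have h2 : y = x * x' * y' + (-c) • (x * x') := by
    rw [← h1, mul_assoc, hy', mul_add, mul_one, mul_smul_comm]
    module
  have h3 : x * (x * x') = c • (x * x') + x' := by
    rw [← mul_assoc, hx, add_mul, smul_mul_assoc, one_mul]
  have h4 : x * y = x * (x * x') * y' + (-c) • (x * (x * x')) := by
    conv_lhs => rw [h2]
    simp only [mul_add, mul_smul_comm, mul_assoc]
  rw [h4, h3]
  conv_rhs => rw [h2]
  simp only [add_mul, smul_mul_assoc]
  module

/-- The key shift identity `t_l t_k = t_{l-1} t_{k-1} + a t_k - a t_{l-1}`. -/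
theorem tH_shift (e n : ℕ) (l k : ZMod e) :
    tH e n l * tH e n k =
      tH e n (l - 1) * tH e n (k - 1) + aP • tH e n k + (-aP) • tH e n (l - 1) :=
  shift_aux aP _ _ _ _ (tH_tt e n k l) (tH_sq e n l) (tH_sq e n (k - 1))

theorem tH_mem (e n : ℕ) (he : 1 ≤ e) (l : ZMod e) :
    tH e n l ∈ Submodule.span R0 (Lam2 e n) := by
  have : NeZero e := ⟨by omega⟩
  exact Submodule.subset_span (Or.inl (Or.inr ⟨l.val, l.val_lt, by simp⟩))

theorem tH_mul_zero_mem (e n : ℕ) (he : 1 ≤ e) (l : ZMod e) :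
    tH e n l * tH e n 0 ∈ Submodule.span R0 (Lam2 e n) := by
  have : NeZero e := ⟨by omega⟩
  by_cases hl : l = 0
  · subst hl
    rw [tH_sq]
    exact add_mem (Submodule.smul_mem _ _ (tH_mem e n he 0))
      (Submodule.subset_span (Or.inl (Or.inl rfl)))
  · refine Submodule.subset_span (Or.inr ⟨l.val, ?_, l.val_lt, by simp⟩)
    exact Nat.one_le_iff_ne_zero.mpr (by simpa using hl)

theorem tH_mul_nat_mem (e n : ℕ) (he : 1 ≤ e) (k : ℕ) : ∀ l : ZMod e,
    tH e n l * tH e n (k : ZMod e) ∈ Submodule.span R0 (Lam2 e n) := by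
  induction k with
  | zero => intro l; simpa using tH_mul_zero_mem e n he l
  | succ k ih =>
    intro l
    rw [tH_shift]
    have h : ((k + 1 : ℕ) : ZMod e) - 1 = k := by simp
    rw [h]
    exact add_mem (add_mem (ih _) (Submodule.smul_mem _ _ (tH_mem e n he _)))
      (Submodule.smul_mem _ _ (tH_mem e n he _))

theorem tH_mul_nat_zero_mem (e n : ℕ) (he : 1 ≤ e) (k : ℕ) : ∀ l : ZMod e,
    tH e n l * tH e n (k : ZMod e) * tH e n 0 ∈ Submodule.span R0 (Lam2 e n) := by
  induction k with
  | zero =>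
    intro l
    rw [Nat.cast_zero, mul_assoc, tH_sq, mul_add, mul_one, mul_smul_comm]
    exact add_mem (Submodule.smul_mem _ _ (tH_mul_zero_mem e n he l)) (tH_mem e n he l)
  | succ k ih =>
    intro l
    rw [tH_shift]
    have h : ((k + 1 : ℕ) : ZMod e) - 1 = k := by simp
    rw [h, add_mul, add_mul, smul_mul_assoc, smul_mul_assoc]
    exact add_mem (add_mem (ih _) (Submodule.smul_mem _ _ (tH_mul_zero_mem e n he _)))
      (Submodule.smul_mem _ _ (tH_mul_zero_mem e n he _))

/-- For every `l ∈ ℤ/eℤ` and every `a₂ ∈ Λ₂`, `t_l · a₂ ∈ Span(Λ₂)`. -/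
theorem t_mul_Lam2_mem_span (e n : ℕ) (he : 1 ≤ e) (hn : 2 ≤ n)
    (hex : ¬(n = 2 ∧ Even e)) (l : ZMod e) (a2 : Hecke e n) (ha2 : a2 ∈ Lam2 e n) :
    tH e n l * a2 ∈ Submodule.span R0 (Lam2 e n) := by
  rcases ha2 with (h | ⟨k, _, rfl⟩) | ⟨k, _, _, rfl⟩
  · rw [Set.mem_singleton_iff.mp h, mul_one]
    exact tH_mem e n he l
  · exact tH_mul_nat_mem e n he k l
  · rw [← mul_assoc]
    exact tH_mul_nat_zero_mem e n he k l
end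
end

section
/- Suppose n ≥ 3. In H(e,e,n), for every 3 ≤ i ≤ n, the element sₙ s_{n−1} ⋯ s₄ s₃² s₄ s₅ ⋯ sᵢ (where the trailing factor s₄ ⋯ sᵢ is empty when i = 3) belongs to Span(S*_{n−1} Λₙ). -/
noncomputable section

open scoped Pointwise

open FreeAlgebra

/-- `S*_{n-1}`: all finite products of elements of `{t₀, …, t_{e-1}, s₃, …, s_{n-1}}`. -/
def Sstar (e n : ℕ) : Set (Hecke e n) :=
  (Submonoid.closure
    ({x | ∃ k < e, x = tH e n (k : ZMod e)} ∪
      {x | ∃ j, 3 ≤ j ∧ j ≤ n - 1 ∧ x = sH e n j}) : Submonoid (Hecke e n))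


theorem sH_sq (e n j : ℕ) (h3 : 3 ≤ j) (hn : j ≤ n) :
    sH e n j * sH e n j = aP • sH e n j + 1 := by
  have h := RingQuot.mkAlgHom_rel R0 (HRel.sq (e := e) j h3 hn)
  simp only [map_mul, map_add, map_one, AlgHom.commutes] at h
  simp only [sH, h3, hn, and_self, dite_true]
  rw [h, Algebra.smul_def]

theorem sH_comm (e n i j : ℕ) (h3i : 3 ≤ i) (hij : i + 1 < j) (hn : j ≤ n) :
    sH e n i * sH e n j = sH e n j * sH e n i := by
  have h3j : 3 ≤ j := by omega
  have hni : i ≤ n := by omega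
  have h := RingQuot.mkAlgHom_rel R0 (HRel.comm (e := e) i j h3i hni h3j hn (Or.inl hij))
  simp only [map_mul] at h
  simpa only [sH, h3i, hn, h3j, hni, and_self, dite_true] using h

theorem sH_braid (e n i : ℕ) (h3 : 3 ≤ i) (hn : i + 1 ≤ n) :
    sH e n i * sH e n (i + 1) * sH e n i = sH e n (i + 1) * sH e n i * sH e n (i + 1) := by
  have h3' : 3 ≤ i + 1 := by omega
  have hn' : i ≤ n := by omega
  have h := RingQuot.mkAlgHom_rel R0 (HRel.braid (e := e) i h3 h3' hn' hn)
  simp only [map_mul] at h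
  simpa only [sH, h3, hn, h3', hn', and_self, dite_true] using h

theorem sDescH_step (e n p : ℕ) (hp : p ≤ n) :
    sDescH e n n p = sDescH e n n (p + 1) * sH e n p := by
  unfold sDescH
  rw [show n + 1 - p = (n + 1 - (p + 1)) + 1 by omega, List.range'_succ]
  simp

theorem sDescH_top (e n : ℕ) : sDescH e n n (n + 1) = 1 := by
  simp [sDescH]

theorem sAscH_empty (e n i : ℕ) : sAscH e n (i + 1) i = 1 := by
  simp [sAscH]

theorem sAscH_left (e n p i : ℕ) (hp : p ≤ i) :
    sAscH e n p i = sH e n p * sAscH e n (p + 1) i := by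
  unfold sAscH
  rw [show i + 1 - p = (i + 1 - (p + 1)) + 1 by omega, List.range'_succ]
  simp

theorem sAscH_right (e n p i : ℕ) (hp : p ≤ i + 1) :
    sAscH e n p (i + 1) = sAscH e n p i * sH e n (i + 1) := by
  unfold sAscH
  rw [show i + 1 + 1 - p = (i + 1 - p) + 1 by omega, List.range'_concat]
  simp [show p + (i + 1 - p) = i + 1 by omega]

theorem sDescH_comm (e n k q : ℕ) (h3 : 3 ≤ k) (hkq : k + 1 < q) (hq : q ≤ n + 1) :
    sDescH e n n q * sH e n k = sH e n k * sDescH e n n q := by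
  induction hq using Nat.decreasingInduction with
  | self => simp [sDescH_top]
  | of_succ q hq ih =>
    have ih := ih (by omega)
    rw [sDescH_step e n q (by omega), mul_assoc, ← sH_comm e n k q h3 hkq (by omega),
      ← mul_assoc, ih, mul_assoc]

theorem sDescH_shift (e n j p : ℕ) (h3 : 3 ≤ p) (hpj : p ≤ j) (hj : j + 1 ≤ n) :
    sDescH e n n p * sH e n (j + 1) = sH e n j * sDescH e n n p := by
  induction hpj using Nat.decreasingInduction with
  | self =>
    rw [sDescH_step e n j (by omega), sDescH_step e n (j + 1) hj]
    have hb := sH_braid e n j h3 hj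
    have hc := sDescH_comm e n j (j + 1 + 1) h3 (by omega) (by omega)
    calc _ = sDescH e n n (j + 1 + 1) * (sH e n (j + 1) * sH e n j * sH e n (j + 1)) := by
            simp only [mul_assoc]
      _ = (sDescH e n n (j + 1 + 1) * sH e n j) * (sH e n (j + 1) * sH e n j) := by
            rw [← hb]; simp only [mul_assoc]
      _ = _ := by rw [hc]; simp only [mul_assoc]
  | of_succ p hp ih =>
    have ih := ih (by omega)
    rw [sDescH_step e n p (by omega), mul_assoc, sH_comm e n p (j + 1) h3 (by omega) hj,
      ← mul_assoc, ih, mul_assoc]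

theorem sDescH_mul_sAscH (e n p i : ℕ) (h3 : 3 ≤ p) (hpi : p ≤ i) (hi : i ≤ n) :
    ∃ u ∈ Sstar e n, sDescH e n n p * sAscH e n (p + 1) i = u * sDescH e n n p := by
  induction i, hpi using Nat.le_induction with
  | base => exact ⟨1, Submonoid.one_mem _, by simp [sAscH_empty]⟩
  | succ i hpi ih =>
    obtain ⟨u, hu, h⟩ := ih (by omega)
    refine ⟨u * sH e n i, Submonoid.mul_mem _ hu (Submonoid.subset_closure
      (Or.inr ⟨i, by omega, by omega, rfl⟩)), ?_⟩
    rw [sAscH_right e n _ i (by omega), ← mul_assoc, h, mul_assoc,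
      sDescH_shift e n i p h3 hpi hi, mul_assoc]

theorem sDescH_mem_LamH (e n p : ℕ) (h3 : 3 ≤ p) (hp : p ≤ n + 1) :
    sDescH e n n p ∈ LamH e n n := by
  rcases Nat.lt_or_ge n p with h | h
  · obtain rfl : p = n + 1 := by omega
    rw [sDescH_top]
    exact Or.inl (Or.inl (Or.inl rfl))
  · exact Or.inl (Or.inl (Or.inr ⟨p, h3, h, rfl⟩))

theorem sDescH_mul_sAscH_mem (e n i p : ℕ) (h3 : 3 ≤ p) (hpi : p ≤ i + 1) (hi : i ≤ n) :
    sDescH e n n p * sAscH e n p i ∈ Submodule.span R0 (Sstar e n * LamH e n n) := by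
  induction hpi using Nat.decreasingInduction with
  | self =>
    rw [sAscH_empty, mul_one, ← one_mul (sDescH e n n (i + 1))]
    exact Submodule.subset_span (Set.mul_mem_mul (Submonoid.one_mem _)
      (sDescH_mem_LamH e n _ h3 (by omega)))
  | of_succ p hp ih =>
    have ih := ih (by omega)
    obtain ⟨u, hu, h⟩ := sDescH_mul_sAscH e n p i h3 (by omega) hi
    have key : sDescH e n n p * sAscH e n p i =
        aP • (u * sDescH e n n p) + sDescH e n n (p + 1) * sAscH e n (p + 1) i := by
      rw [← h, sAscH_left e n p i (by omega), sDescH_step e n p (by omega)]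
      calc _ = sDescH e n n (p + 1) * (sH e n p * sH e n p) * sAscH e n (p + 1) i := by
              simp only [mul_assoc]
        _ = _ := by
              rw [sH_sq e n p h3 (by omega), mul_add, add_mul, mul_one, mul_smul_comm,
                smul_mul_assoc]
    rw [key]
    exact Submodule.add_mem _ (Submodule.smul_mem _ _ (Submodule.subset_span
      (Set.mul_mem_mul hu (sDescH_mem_LamH e n _ h3 (by omega))))) ih

/-- For `3 ≤ i ≤ n`, the element `sₙ ⋯ s₄ s₃² s₄ ⋯ sᵢ` lies in `Span(S*_{n-1} Λₙ)`. -/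
theorem sns3sq_mem_span (e n : ℕ) (he : 1 ≤ e) (hn : 3 ≤ n)
    (hex : ¬(n = 2 ∧ Even e)) (i : ℕ) (h3 : 3 ≤ i) (hi : i ≤ n) :
    sDescH e n n 3 * sH e n 3 * sAscH e n 4 i ∈
      Submodule.span R0 (Sstar e n * LamH e n n) := by
  rw [mul_assoc, ← sAscH_left e n 3 i h3]
  exact sDescH_mul_sAscH_mem e n i 3 le_rfl (by omega) hi
end
end
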